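/- The set of 2-friezes of height 3 is finite. -/

import Mathlib

/-- A 2-frieze of height `h`: a function `a : ℤ × {0,…,h+1} → ℤ` with `a(i,0) = a(i,h+1) = 1`,
`a(i,j) ≥ 1` for `1 ≤ j ≤ h`, and `a(i,j) = a(i-1,j)·a(i+1,j) - a(i,j-1)·a(i,j+1)`
for `1 ≤ j ≤ h`. -/
def Is2Frieze (h : ℕ) (a : ℤ → Fin (h + 2) → ℤ) : Prop :=
  (∀ i : ℤ, a i ⟨0, by omega⟩ = 1) ∧
  (∀ i : ℤ, a i ⟨h + 1, by omega⟩ = 1) ∧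
  (∀ i : ℤ, ∀ j : ℕ, ∀ _ : 1 ≤ j, ∀ _ : j ≤ h, 1 ≤ a i ⟨j, by omega⟩) ∧
  (∀ i : ℤ, ∀ j : ℕ, ∀ _ : 1 ≤ j, ∀ _ : j ≤ h,
    a i ⟨j, by omega⟩ =
      a (i - 1) ⟨j, by omega⟩ * a (i + 1) ⟨j, by omega⟩ -
        a i ⟨j - 1, by omega⟩ * a i ⟨j + 1, by omega⟩)

/-- Three steps of the recurrence, with explicit Laurent polynomials. -/
theorem step_formulas (a b c d e f x2 y2 z2 x3 y3 z3 x4 y4 z4 : ℚ)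
    (ha : 0 < a) (hb : 0 < b) (hc : 0 < c) (hd : 0 < d) (he : 0 < e) (hf : 0 < f)
    (h1 : a * x2 = d + e) (h2 : b * y2 = e + d * f) (h3 : c * z2 = f + e)
    (h4 : d * x3 = x2 + y2) (h5 : e * y3 = y2 + x2 * z2) (h6 : f * z3 = z2 + y2)
    (h7 : x2 * x4 = x3 + y3) (h8 : y2 * y4 = y3 + x3 * z3) (h9 : z2 * z4 = z3 + y3) :
    x2 = (d + e) / a ∧ y2 = (e + d * f) / b ∧ z2 = (f + e) / c ∧
    x3 = (b * (d + e) + a * (e + d * f)) / (a * b * d) ∧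
    y3 = (a * c * (e + d * f) + b * (d + e) * (e + f)) / (a * b * c * e) ∧
    z3 = (b * (e + f) + c * (e + d * f)) / (b * c * f) ∧
    x4 = (b * c * e + a * c * (e + d * f) + b * d * (e + f)) / (b * c * d * e) ∧
    y4 = (a * b * c * d * f + b ^ 2 * (d + e) * (e + f) + b * c * e * (d + e)
      + a * b * e * (e + f) + a * c * e * (e + d * f)) / (a * b * c * d * e * f) ∧
    z4 = (a * b * e + a * c * (e + d * f) + b * f * (e + d)) / (a * b * e * f) := by
  have k1 : x2 = (d + e) / a := by rw [← h1]; field_simp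
  have k2 : y2 = (e + d * f) / b := by rw [← h2]; field_simp
  have k3 : z2 = (f + e) / c := by rw [← h3]; field_simp
  have k4 : x3 = (b * (d + e) + a * (e + d * f)) / (a * b * d) := by
    apply mul_left_cancel₀ hd.ne'
    rw [h4, k1, k2]; field_simp
  have k5 : y3 = (a * c * (e + d * f) + b * (d + e) * (e + f)) / (a * b * c * e) := by
    apply mul_left_cancel₀ he.ne'
    rw [h5, k1, k2, k3]; field_simp; ring
  have k6 : z3 = (b * (e + f) + c * (e + d * f)) / (b * c * f) := by
    apply mul_left_cancel₀ hf.ne'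
    rw [h6, k2, k3]; field_simp; ring
  have p1 : 0 < x2 := by rw [k1]; positivity
  have p2 : 0 < y2 := by rw [k2]; positivity
  have p3 : 0 < z2 := by rw [k3]; positivity
  refine ⟨k1, k2, k3, k4, k5, k6, ?_, ?_, ?_⟩
  · apply mul_left_cancel₀ p1.ne'
    rw [h7, k1, k4, k5]; field_simp; ring
  · apply mul_left_cancel₀ p2.ne'
    rw [h8, k2, k4, k5, k6]; field_simp; ring
  · apply mul_left_cancel₀ p3.ne'
    rw [h9, k3, k5, k6]; field_simp; ring

/-- Positive integer sequences satisfying the height 3 recurrences. -/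
def GoodSeq (x y z : ℤ → ℤ) : Prop :=
  ∀ i, 1 ≤ x i ∧ 1 ≤ y i ∧ 1 ≤ z i ∧ x (i - 1) * x (i + 1) = x i + y i ∧
    y (i - 1) * y (i + 1) = y i + x i * z i ∧ z (i - 1) * z (i + 1) = z i + y i

/-- The glide symmetry and the two exchange relations. -/
theorem good_identities {x y z : ℤ → ℤ} (h : GoodSeq x y z) (i : ℤ) :
    x (i + 7) = z i ∧ z (i + 7) = x i ∧ y (i + 7) = y i ∧
    (x i * x (i + 3) - 1) * (x (i + 3) * x (i + 6) - 1)
      = 1 + x (i + 3) * (y (i + 1) * y (i + 5) - 1) ∧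
    (y i * y (i + 3) - 1) * (y (i + 3) * y (i + 6) - 1)
      = 1 + y (i + 3) * ((x (i + 5) * z (i + 1) - 1) * (z (i + 5) * x (i + 1) - 1)) := by
  have R : ∀ j k l : ℤ, j + 1 = k → k + 1 = l →
      ((x j : ℚ) * x l = x k + y k) ∧ ((y j : ℚ) * y l = y k + x k * z k) ∧
      ((z j : ℚ) * z l = z k + y k) := by
    intro j k l hj hk
    obtain ⟨-, -, -, q1, q2, q3⟩ := h k
    have e1 : k - 1 = j := by omega
    rw [e1, hk] at q1 q2 q3
    exact ⟨by exact_mod_cast q1, by exact_mod_cast q2, by exact_mod_cast q3⟩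
  have P : ∀ k, (0 : ℚ) < x k ∧ (0 : ℚ) < y k ∧ (0 : ℚ) < z k := by
    intro k
    obtain ⟨q1, q2, q3, -⟩ := h k
    exact ⟨by exact_mod_cast q1, by exact_mod_cast q2, by exact_mod_cast q3⟩
  obtain ⟨a1, a2, a3⟩ := R (i + 3) (i + 4) (i + 5) (by ring) (by ring)
  obtain ⟨b1, b2, b3⟩ := R (i + 4) (i + 5) (i + 6) (by ring) (by ring)
  obtain ⟨c1, c2, c3⟩ := R (i + 5) (i + 6) (i + 7) (by ring) (by ring)
  obtain ⟨d1, d2, d3⟩ := R (i + 2) (i + 3) (i + 4) (by ring) (by ring)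
  obtain ⟨e1, e2, e3⟩ := R (i + 1) (i + 2) (i + 3) (by ring) (by ring)
  obtain ⟨f1, f2, f3⟩ := R i (i + 1) (i + 2) (by ring) (by ring)
  obtain ⟨pa, pb, pc⟩ := P (i + 3)
  obtain ⟨pd, pe, pf⟩ := P (i + 4)
  obtain ⟨x5, y5, z5, x6, y6, z6, x7, y7, z7⟩ :=
    step_formulas _ _ _ _ _ _ _ _ _ _ _ _ _ _ _ pa pb pc pd pe pf a1 a2 a3 b1 b2 b3 c1 c2 c3
  rw [mul_comm] at d1 d2 d3 e1 e2 e3 f1 f2 f3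
  obtain ⟨x2, y2, z2, x1, y1, z1, x0, y0, z0⟩ :=
    step_formulas _ _ _ _ _ _ _ _ _ _ _ _ _ _ _ pd pe pf pa pb pc d1 d2 d3 e1 e2 e3 f1 f2 f3
  refine ⟨?_, ?_, ?_, ?_, ?_⟩
  · have : (x (i + 7) : ℚ) = z i := by rw [x7, z0]; field_simp; ring
    exact_mod_cast this
  · have : (z (i + 7) : ℚ) = x i := by rw [z7, x0]; field_simp; ring
    exact_mod_cast this
  · have : (y (i + 7) : ℚ) = y i := by rw [y7, y0]; field_simp; ring
    exact_mod_cast this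
  · have : ((x i : ℚ) * x (i + 3) - 1) * (x (i + 3) * x (i + 6) - 1)
      = 1 + x (i + 3) * (y (i + 1) * y (i + 5) - 1) := by
      rw [x0, x6, y1, y5]; field_simp; ring
    exact_mod_cast this
  · have : ((y i : ℚ) * y (i + 3) - 1) * (y (i + 3) * y (i + 6) - 1)
      = 1 + y (i + 3) * ((x (i + 5) * z (i + 1) - 1) * (z (i + 5) * x (i + 1) - 1)) := by
      rw [y0, y6, x5, z1, z5, x1]; field_simp; ring
    exact_mod_cast this

theorem sum_shift {f : ℤ → ℝ} (hf : ∀ i, f (i + 14) = f i) (m : ℤ) :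
    ∑ k ∈ Finset.range 14, f (k + m) = ∑ k ∈ Finset.range 14, f k := by
  have key : ∀ m : ℤ, ∑ k ∈ Finset.range 14, f (k + (m + 1)) =
      ∑ k ∈ Finset.range 14, f (k + m) := by
    intro m
    have h1 := Finset.sum_range_succ (fun k : ℕ => f (k + m)) 14
    have h2 := Finset.sum_range_succ' (fun k : ℕ => f (k + m)) 14
    have h3 : f (((14 : ℕ) : ℤ) + m) = f (((0 : ℕ) : ℤ) + m) := by
      rw [← hf (((0 : ℕ) : ℤ) + m)]; congr 1; push_cast; ring
    have h4 : ∀ k : ℕ, f (((k + 1 : ℕ) : ℤ) + m) = f (k + (m + 1)) := by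
      intro k; congr 1; push_cast; ring
    simp only [h4] at h2
    linarith
  induction m using Int.induction_on with
  | zero => simp
  | succ n ih => rw [key, ih]
  | pred n ih => rw [← ih, ← key]; simp

theorem log_exchange {A B C : ℤ} (hA : 1 ≤ A) (hB : 1 ≤ B) (hC : 1 ≤ C) (h : A * B = 1 + C) :
    Real.log A + Real.log B ≤ Real.log 2 + Real.log C := by
  have hA' : (0 : ℝ) < A := by exact_mod_cast hA
  have hB' : (0 : ℝ) < B := by exact_mod_cast hB
  have hC' : (0 : ℝ) < C := by exact_mod_cast hC
  rw [← Real.log_mul hA'.ne' hB'.ne', ← Real.log_mul two_ne_zero hC'.ne']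
  apply Real.log_le_log (by positivity)
  have : A * B ≤ 2 * C := by omega
  exact_mod_cast this

theorem one_le_of_mul {A B : ℤ} (hA : 0 ≤ A) (h : 1 ≤ A * B) : 1 ≤ A := by
  rcases hA.eq_or_lt with h0 | h0
  · rw [← h0] at h; simp at h
  · omega

theorem good_bound {x y z : ℤ → ℤ} (h : GoodSeq x y z) (i : ℤ) :
    x i ≤ 2 ^ 154 ∧ y i ≤ 2 ^ 154 := by
  have hx : ∀ i, 1 ≤ x i := fun i => (h i).1
  have hy : ∀ i, 1 ≤ y i := fun i => (h i).2.1
  have px : ∀ i, x (i + 7) = z i := fun i => (good_identities h i).1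
  have py : ∀ i, y (i + 7) = y i := fun i => (good_identities h i).2.2.1
  have px14 : ∀ i, x (i + 14) = x i := by
    intro i
    rw [← (good_identities h i).2.1, ← px]; congr 1; ring
  have py14 : ∀ i, y (i + 14) = y i := by
    intro i
    rw [← py i, ← py (i + 7)]; congr 1; ring
  obtain ⟨T, hT⟩ : ∃ T : ℤ → ℤ, ∀ i, T i = x i * x (i + 3) - 1 := ⟨_, fun _ => rfl⟩
  obtain ⟨U, hU⟩ : ∃ U : ℤ → ℤ, ∀ i, U i = y i * y (i + 3) - 1 := ⟨_, fun _ => rfl⟩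
  have rT : ∀ i, T i * T (i + 3) = 1 + x (i + 3) * U (i + 5) := by
    intro i
    have := (good_identities h i).2.2.2.1
    have e1 : y (i + 5 + 3) = y (i + 1) := by rw [← py (i + 1)]; congr 1; ring
    have e2 : x (i + 3 + 3) = x (i + 6) := by congr 1; ring
    rw [hT, hT, hU, e1, e2, this]; ring
  have rU : ∀ i, U i * U (i + 3) = 1 + y (i + 3) * (T (i + 5) * T (i + 12)) := by
    intro i
    have := (good_identities h i).2.2.2.2
    have e1 : y (i + 3 + 3) = y (i + 6) := by congr 1; ring
    have e2 : x (i + 5 + 3) = z (i + 1) := by rw [← px (i + 1)]; congr 1; ring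
    have e3 : x (i + 12) = z (i + 5) := by rw [← px (i + 5)]; congr 1; ring
    have e4 : x (i + 12 + 3) = x (i + 1) := by rw [← px14 (i + 1)]; congr 1; ring
    rw [hU, hU, hT, hT, e1, e2, e3, e4, this]
  have T0 : ∀ i, 0 ≤ T i := by
    intro i; rw [hT]; nlinarith [hx i, hx (i + 3)]
  have U0 : ∀ i, 0 ≤ U i := by
    intro i; rw [hU]; nlinarith [hy i, hy (i + 3)]
  have T1 : ∀ i, 1 ≤ T i := by
    intro i
    apply one_le_of_mul (T0 i) (B := T (i + 3))
    rw [rT]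
    have := mul_nonneg (zero_le_one.trans (hx (i + 3))) (U0 (i + 5))
    omega
  have U1 : ∀ i, 1 ≤ U i := by
    intro i
    apply one_le_of_mul (U0 i) (B := U (i + 3))
    rw [rU]
    have := mul_nonneg (zero_le_one.trans (hy (i + 3))) (mul_nonneg (T0 (i + 5)) (T0 (i + 12)))
    omega
  have one_mul_le : ∀ {A B : ℤ}, 1 ≤ A → 1 ≤ B → 1 ≤ A * B := by
    intro A B hA hB; nlinarith
  have lm : ∀ {A B : ℤ}, 1 ≤ A → 1 ≤ B →
      Real.log ((A * B : ℤ) : ℝ) = Real.log A + Real.log B := by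
    intro A B hA hB
    have hA' : (0 : ℝ) < A := by exact_mod_cast hA
    have hB' : (0 : ℝ) < B := by exact_mod_cast hB
    push_cast
    exact Real.log_mul hA'.ne' hB'.ne'
  obtain ⟨lx, hlx⟩ : ∃ l : ℤ → ℝ, ∀ i, l i = Real.log (x i) := ⟨_, fun _ => rfl⟩
  obtain ⟨ly, hly⟩ : ∃ l : ℤ → ℝ, ∀ i, l i = Real.log (y i) := ⟨_, fun _ => rfl⟩
  obtain ⟨lT, hlT⟩ : ∃ l : ℤ → ℝ, ∀ i, l i = Real.log (T i) := ⟨_, fun _ => rfl⟩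
  obtain ⟨lU, hlU⟩ : ∃ l : ℤ → ℝ, ∀ i, l i = Real.log (U i) := ⟨_, fun _ => rfl⟩
  have i1 : ∀ i, lx i + lx (i + 3) ≤ Real.log 2 + lT i := by
    intro i
    rw [hlx, hlx, hlT]
    exact log_exchange (hx _) (hx _) (T1 _) (by rw [hT]; ring)
  have i2 : ∀ i, ly i + ly (i + 3) ≤ Real.log 2 + lU i := by
    intro i
    rw [hly, hly, hlU]
    exact log_exchange (hy _) (hy _) (U1 _) (by rw [hU]; ring)
  have i3 : ∀ i, lT i + lT (i + 3) ≤ Real.log 2 + (lx (i + 3) + lU (i + 5)) := by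
    intro i
    rw [hlT, hlT, hlx, hlU, ← lm (hx _) (U1 _)]
    exact log_exchange (T1 _) (T1 _) (one_mul_le (hx _) (U1 _)) (rT i)
  have i4 : ∀ i, lU i + lU (i + 3) ≤
      Real.log 2 + (ly (i + 3) + (lT (i + 5) + lT (i + 12))) := by
    intro i
    rw [hlU, hlU, hly, hlT, hlT, ← lm (T1 _) (T1 _), ← lm (hy _) (one_mul_le (T1 _) (T1 _))]
    exact log_exchange (U1 _) (U1 _) (one_mul_le (hy _) (one_mul_le (T1 _) (T1 _))) (rU i)
  have qx : ∀ i, lx (i + 14) = lx i := by intro i; rw [hlx, hlx, px14]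
  have qy : ∀ i, ly (i + 14) = ly i := by intro i; rw [hly, hly, py14]
  have qT : ∀ i, lT (i + 14) = lT i := by
    intro i
    rw [hlT, hlT, hT, hT, px14, show i + 14 + 3 = i + 3 + 14 by ring, px14]
  have qU : ∀ i, lU (i + 14) = lU i := by
    intro i
    rw [hlU, hlU, hU, hU, py14, show i + 14 + 3 = i + 3 + 14 by ring, py14]
  have s1 := Finset.sum_le_sum (s := Finset.range 14) fun (k : ℕ) _ => i1 k
  have s2 := Finset.sum_le_sum (s := Finset.range 14) fun (k : ℕ) _ => i2 k
  have s3 := Finset.sum_le_sum (s := Finset.range 14) fun (k : ℕ) _ => i3 k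
  have s4 := Finset.sum_le_sum (s := Finset.range 14) fun (k : ℕ) _ => i4 k
  simp only [Finset.sum_add_distrib, sum_shift qx, sum_shift qy, sum_shift qT, sum_shift qU,
    Finset.sum_const, Finset.card_range, nsmul_eq_mul] at s1 s2 s3 s4
  push_cast at s1 s2 s3 s4
  have l2 : 0 < Real.log 2 := Real.log_pos (by norm_num)
  have bx : lx i ≤ ∑ k ∈ Finset.range 14, lx k := by
    rw [← sum_shift qx i]
    have := Finset.single_le_sum (s := Finset.range 14) (f := fun k : ℕ => lx (k + i)) (a := 0)
      (fun k _ => by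
        rw [hlx]; exact Real.log_nonneg (by exact_mod_cast hx _)) (by simp)
    simpa using this
  have hby : ly i ≤ ∑ k ∈ Finset.range 14, ly k := by
    rw [← sum_shift qy i]
    have := Finset.single_le_sum (s := Finset.range 14) (f := fun k : ℕ => ly (k + i)) (a := 0)
      (fun k _ => by
        rw [hly]; exact Real.log_nonneg (by exact_mod_cast hy _)) (by simp)
    simpa using this
  have to_bound : ∀ A : ℤ, 1 ≤ A → Real.log A ≤ 154 * Real.log 2 → A ≤ 2 ^ 154 := by
    intro A hA hl
    have hA' : (0 : ℝ) < A := by exact_mod_cast hA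
    have e : (154 : ℝ) * Real.log 2 = Real.log ((2 : ℝ) ^ 154) := by
      rw [Real.log_pow]; norm_num
    rw [e] at hl
    have := (Real.log_le_log_iff hA' (by positivity)).1 hl
    exact_mod_cast this
  constructor
  · apply to_bound _ (hx i)
    rw [← hlx]
    linarith
  · apply to_bound _ (hy i)
    rw [← hly]
    linarith

theorem statement10 :
    {a : ℤ → Fin 5 → ℤ | Is2Frieze 3 a}.Finite := by
  have good : ∀ a : ℤ → Fin 5 → ℤ, Is2Frieze 3 a →
      GoodSeq (fun i => a i 1) (fun i => a i 2) (fun i => a i 3) ∧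
      (∀ i, a i 0 = 1) ∧ (∀ i, a i 4 = 1) := by
    rintro a ⟨h0, h4, hp, hr⟩
    have h0' : ∀ i, a i 0 = 1 := h0
    have h4' : ∀ i, a i 4 = 1 := h4
    refine ⟨fun i => ?_, h0', h4'⟩
    have r1 : a i 1 = a (i - 1) 1 * a (i + 1) 1 - a i 0 * a i 2 :=
      hr i 1 (by norm_num) (by norm_num)
    have r2 : a i 2 = a (i - 1) 2 * a (i + 1) 2 - a i 1 * a i 3 :=
      hr i 2 (by norm_num) (by norm_num)
    have r3 : a i 3 = a (i - 1) 3 * a (i + 1) 3 - a i 2 * a i 4 :=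
      hr i 3 (by norm_num) (by norm_num)
    rw [h0'] at r1
    rw [h4'] at r3
    refine ⟨hp i 1 (by norm_num) (by norm_num), hp i 2 (by norm_num) (by norm_num),
      hp i 3 (by norm_num) (by norm_num), ?_, ?_, ?_⟩ <;> dsimp only <;> linarith
  have per : ∀ a : ℤ → Fin 5 → ℤ, Is2Frieze 3 a → ∀ i j, a (i + 14) j = a i j := by
    intro a ha i j
    obtain ⟨g, h0, h4⟩ := good a ha
    have e : i + 14 = i + 7 + 7 := by ring
    obtain ⟨p1, p2, p3, -⟩ := good_identities g i
    obtain ⟨q1, q2, q3, -⟩ := good_identities g (i + 7)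
    rw [e]
    fin_cases j
    · exact (h0 _).trans (h0 _).symm
    · exact q1.trans p2
    · exact q3.trans p3
    · exact q2.trans p1
    · exact (h4 _).trans (h4 _).symm
  apply Set.Finite.of_finite_image (f := fun a => fun (k : Fin 14) (j : Fin 5) => a (k : ℕ) j)
  · apply Set.Finite.subset (Set.finite_Icc (fun (_ : Fin 14) (_ : Fin 5) => (1 : ℤ))
      (fun _ _ => 2 ^ 154))
    rintro _ ⟨a, ha, rfl⟩
    obtain ⟨g, h0, h4⟩ := good a ha
    have hb : ∀ i j, 1 ≤ a i j ∧ a i j ≤ 2 ^ 154 := by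
      intro i j
      have t : (1 : ℤ) ≤ 2 ^ 154 := by norm_num
      have b := good_bound g i
      have b' := good_bound g (i + 7)
      rw [(good_identities g i).1] at b'
      obtain ⟨p1, p2, p3, -⟩ := g i
      fin_cases j
      · exact ⟨(h0 i).ge, (h0 i).le.trans t⟩
      · exact ⟨p1, b.1⟩
      · exact ⟨p2, b.2⟩
      · exact ⟨p3, b'.1⟩
      · exact ⟨(h4 i).ge, (h4 i).le.trans t⟩
    exact ⟨fun k j => (hb _ j).1, fun k j => (hb _ j).2⟩
  · intro a ha b hb hab
    have mult : ∀ a : ℤ → Fin 5 → ℤ, Is2Frieze 3 a → ∀ (m i : ℤ) (j), a (i + 14 * m) j = a i j := by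
      intro a ha m
      induction m using Int.induction_on with
      | zero => intro i j; simp
      | succ n ih =>
        intro i j
        rw [← ih i j, ← per a ha (i + 14 * n) j]; congr 1; ring
      | pred n ih =>
        intro i j
        rw [← ih i j, ← per a ha _ j]; congr 1; ring
    funext i j
    have hm := Int.emod_add_mul_ediv i 14
    rw [← hm, mult a ha, mult b hb]
    have hlt := Int.emod_lt_of_pos i (b := 14) (by norm_num)
    have hnn := Int.emod_nonneg i (b := 14) (by norm_num)
    have := congrFun (congrFun hab ⟨(i % 14).toNat, by omega⟩) j
    simpa [Int.toNat_of_nonneg hnn] using this
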